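/- Trees are compact: let G be a simple graph on Fin n (with n > 0) that is a tree (connected and acyclic), with adjacency matrix A. Then every doubly stochastic n×n real matrix X satisfying X * A = A * X lies in the convex hull of the set of permutation matrices P_σ where σ ranges over the automorphisms of G. -/

import Mathlib

open Matrix Finset

/-- The permutation matrix of `σ`: entry `i j` is `1` if `σ j = i`, else `0`. -/
def permMatrix (n : ℕ) (σ : Equiv.Perm (Fin n)) : Matrix (Fin n) (Fin n) ℝ :=
  fun i j => if σ j = i then 1 else 0

/-- A matrix is doubly stochastic if it has nonnegative entries and all its
row sums and column sums equal `1`. -/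
def IsDoublyStochastic {n : ℕ} (X : Matrix (Fin n) (Fin n) ℝ) : Prop :=
  (∀ i j, 0 ≤ X i j) ∧ (∀ i, ∑ j, X i j = 1) ∧ (∀ j, ∑ i, X i j = 1)

open scoped Classical in
lemma sum_sub_aux {V : Type} [Fintype V] (p : V → Prop) [Fintype {v // p v}] (F : V → ℝ)
    (hF : ∀ v, ¬ p v → F v = 0) : ∑ v : {v // p v}, F v = ∑ v, F v := by
  rw [← Finset.sum_subtype (univ.filter p) (by simp) F]
  apply Finset.sum_subset (Finset.subset_univ _)
  intro v _ hv
  exact hF v (by simpa using hv)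

open scoped Classical in
lemma hall_aux {α β : Type} [Fintype α] [Fintype β] (M : α → β → ℝ) (c : ℝ) (hc : 0 < c)
    (h0 : ∀ a b, 0 ≤ M a b) (hr : ∀ a, ∑ b, M a b = c) (hcol : ∀ b, ∑ a, M a b = c) :
    ∃ f : α → β, Function.Injective f ∧ ∀ a, 0 < M a (f a) := by
  have := (Finset.all_card_le_biUnion_card_iff_exists_injective
    (fun a : α => (univ.filter (fun b : β => 0 < M a b)))).1 (by
      intro S
      set N := S.biUnion (fun a : α => (univ.filter (fun b : β => 0 < M a b))) with hN
      have h1 : (S.card : ℝ) * c ≤ (N.card : ℝ) * c := by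
        calc (S.card : ℝ) * c = ∑ a ∈ S, ∑ b, M a b := by simp [hr]
          _ = ∑ a ∈ S, ∑ b ∈ N, M a b := by
            refine Finset.sum_congr rfl fun a ha => ?_
            symm
            apply Finset.sum_subset (Finset.subset_univ _)
            intro b _ hb
            by_contra hne
            apply hb
            rw [hN, Finset.mem_biUnion]
            exact ⟨a, ha, by simpa using lt_of_le_of_ne (h0 a b) (Ne.symm hne)⟩
          _ = ∑ b ∈ N, ∑ a ∈ S, M a b := Finset.sum_comm
          _ ≤ ∑ b ∈ N, ∑ a, M a b := by
            refine Finset.sum_le_sum fun b _ => ?_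
            exact Finset.sum_le_sum_of_subset_of_nonneg (Finset.subset_univ _)
              (fun a _ _ => h0 a b)
          _ = (N.card : ℝ) * c := by simp [hcol]
      exact_mod_cast le_of_mul_le_mul_right h1 hc)
  obtain ⟨f, hf, hm⟩ := this
  exact ⟨f, hf, fun a => by simpa using hm a⟩

open scoped Classical in
/-- Degree as a real number. -/
noncomputable def rdeg {V : Type} [Fintype V] (G : SimpleGraph V) (v : V) : ℝ :=
  ∑ k, if G.Adj v k then 1 else 0

open scoped Classical in
lemma rdeg_eq {V : Type} [Fintype V] (G : SimpleGraph V) (v : V) :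
    rdeg G v = (G.degree v : ℝ) := by
  simp [rdeg, ← SimpleGraph.card_neighborFinset_eq_degree, SimpleGraph.neighborFinset_eq_filter]

open scoped Classical in
lemma deg_pres {V : Type} [Fintype V] (G : SimpleGraph V) (X : V → V → ℝ)
    (h0 : ∀ i j, 0 ≤ X i j) (hr : ∀ i, ∑ j, X i j = 1) (hcl : ∀ j, ∑ i, X i j = 1)
    (hcomm : ∀ i j, (∑ k, if G.Adj k j then X i k else 0) = ∑ k, if G.Adj i k then X k j else 0)
    (i j : V) (hij : X i j ≠ 0) : rdeg G i = rdeg G j := by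
  have hrow : ∀ i, ∑ j, X i j * rdeg G j = rdeg G i := by
    intro i
    have h := Finset.sum_congr (rfl : (univ : Finset V) = univ) (fun j _ => hcomm i j)
    rw [Finset.sum_comm, Finset.sum_comm (s := univ) (t := univ)
      (f := fun j k => if G.Adj i k then X k j else 0)] at h
    have e1 : ∀ k, (∑ j, if G.Adj k j then X i k else 0) = X i k * rdeg G k := by
      intro k; simp only [rdeg, Finset.mul_sum, mul_ite, mul_one, mul_zero]
    have e2 : ∀ k, (∑ j, if G.Adj i k then X k j else 0) = if G.Adj i k then 1 else 0 := by
      intro k; split_ifs <;> simp [hr]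
    simp only [e1, e2] at h
    exact h
  have key : ∑ i, ∑ j, X i j * (rdeg G i - rdeg G j) ^ 2 = 0 := by
    have e : ∀ i j, X i j * (rdeg G i - rdeg G j) ^ 2 =
        rdeg G i ^ 2 * X i j + X i j * rdeg G j ^ 2 - 2 * rdeg G i * (X i j * rdeg G j) := by
      intro i j; ring
    simp only [e, Finset.sum_add_distrib, Finset.sum_sub_distrib, ← Finset.mul_sum, hrow, hr]
    rw [Finset.sum_comm]
    simp only [← Finset.sum_mul, hcl]
    rw [mul_one]
    rw [← Finset.sum_add_distrib, ← Finset.sum_sub_distrib]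
    apply Finset.sum_eq_zero
    intros; ring
  have nn : ∀ i j, 0 ≤ X i j * (rdeg G i - rdeg G j) ^ 2 :=
    fun i j => mul_nonneg (h0 i j) (sq_nonneg _)
  have k1 := (Finset.sum_eq_zero_iff_of_nonneg
    (fun i _ => Finset.sum_nonneg fun j _ => nn i j)).1 key i (mem_univ _)
  have k2 := (Finset.sum_eq_zero_iff_of_nonneg (fun j _ => nn i j)).1 k1 j (mem_univ _)
  rcases mul_eq_zero.1 k2 with h | h
  · exact absurd h hij
  · exact sub_eq_zero.1 (pow_eq_zero_iff two_ne_zero |>.1 h)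

open scoped Classical in
lemma exists_auto : ∀ (m : ℕ) (V : Type) [Fintype V] (G : SimpleGraph V) (X : V → V → ℝ),
    Fintype.card V = m → G.IsTree →
    (∀ i j, 0 ≤ X i j) → (∀ i, ∑ j, X i j = 1) → (∀ j, ∑ i, X i j = 1) →
    (∀ i j, (∑ k, if G.Adj k j then X i k else 0) = ∑ k, if G.Adj i k then X k j else 0) →
    ∃ f : V → V, Function.Injective f ∧ (∀ u v, G.Adj u v ↔ G.Adj (f u) (f v)) ∧
      ∀ v, 0 < X (f v) v := by
  intro m
  induction m using Nat.strong_induction_on with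
  | _ m ih =>
  intro V _ G X hm hT h0 hr hcl hcomm
  obtain ⟨f0, f0inj, f0pos⟩ := hall_aux (fun a b => X b a) 1 one_pos (fun a b => h0 b a) hcl hr
  by_cases hcomplete : ∀ u v : V, u ≠ v → G.Adj u v
  · refine ⟨f0, f0inj, fun u v => ⟨fun h => ?_, fun h => ?_⟩, f0pos⟩
    · exact hcomplete _ _ (f0inj.ne h.ne)
    · exact hcomplete _ _ (fun e => h.ne (by rw [e]))
  have hdeg : ∀ i j, X i j ≠ 0 → (G.degree i = 1 ↔ G.degree j = 1) := by
    intro i j hij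
    have := deg_pres G X h0 hr hcl hcomm i j hij
    rw [rdeg_eq, rdeg_eq] at this
    rw [Nat.cast_inj.1 this]
  have hleaf : ∀ l, G.degree l = 1 → ∃ p, ∀ w, G.Adj l w ↔ w = p := by
    intro l hl
    obtain ⟨p, hp, hu⟩ := SimpleGraph.degree_eq_one_iff_existsUnique_adj.1 hl
    exact ⟨p, fun w => ⟨fun h => hu w h, fun h => h ▸ hp⟩⟩
  have hnl : ∀ l p, G.degree l = 1 → G.Adj l p → G.degree p ≠ 1 := by
    intro a b ha hab hb
    apply hcomplete
    obtain ⟨b', hb'⟩ := hleaf a ha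
    obtain ⟨a', ha'⟩ := hleaf b hb
    obtain rfl := (hb' b).1 hab
    obtain rfl := (ha' a).1 hab.symm
    have hall : ∀ w, w = a ∨ w = b := by
      intro w
      obtain ⟨p⟩ := hT.1.preconnected w a
      induction p with
      | nil => exact Or.inl rfl
      | cons h p ihp =>
        rcases ihp ha hab hb' ha' with h' | h'
        · subst h'; exact Or.inr ((hb' _).1 h.symm)
        · subst h'; exact Or.inl ((ha' _).1 h.symm)
    intro u v huv
    rcases hall u with rfl | rfl <;> rcases hall v with rfl | rfl
    · exact absurd rfl huv
    · exact hab
    · exact hab.symm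
    · exact absurd rfl huv
  -- the pruned tree
  choose! par hpar using hleaf
  let S : Set V := {v | G.degree v ≠ 1}
  have parS : ∀ l, G.degree l = 1 → G.degree (par l) ≠ 1 := fun l hl =>
    hnl l _ hl ((hpar l hl _).2 rfl)
  have hnt : Nontrivial V := by
    by_contra hn
    rw [not_nontrivial_iff_subsingleton] at hn
    exact hcomplete fun u v huv => absurd (Subsingleton.elim u v) huv
  obtain ⟨l0, hl0⟩ := hT.exists_vert_degree_one_of_nontrivial
  let ret : V → S := fun v => if h : G.degree v = 1 then ⟨par v, parS v h⟩ else ⟨v, h⟩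
  have hconn : ∀ u v, G.Reachable u v → (G.induce S).Reachable (ret u) (ret v) := by
    rintro u v ⟨p⟩
    induction p with
    | nil => exact SimpleGraph.Reachable.refl _
    | @cons a b c h p ihp =>
      refine SimpleGraph.Reachable.trans ?_ ihp
      by_cases ha : G.degree a = 1
      · have hb := hnl a b ha h
        have e : ret a = ret b := by
          simp only [ret, ha, hb, dif_pos, dif_neg, not_false_eq_true]
          exact Subtype.ext ((hpar a ha b).1 h).symm
        rw [e]
      · by_cases hb : G.degree b = 1
        · have e : ret a = ret b := by
            simp only [ret, ha, hb, dif_pos, dif_neg, not_false_eq_true]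
            exact Subtype.ext ((hpar b hb a).1 h.symm)
          rw [e]
        · apply SimpleGraph.Adj.reachable
          simpa [ret, ha, hb] using h
  have hT' : (G.induce S).IsTree := by
    refine ⟨?_, hT.2.induce S⟩
    have : Nonempty S := ⟨ret l0⟩
    refine SimpleGraph.Connected.mk ?_
    rintro ⟨u, hu⟩ ⟨v, hv⟩
    have := hconn u v (hT.1.preconnected u v)
    have hu' : G.degree u ≠ 1 := hu
    have hv' : G.degree v ≠ 1 := hv
    simpa [ret, hu', hv'] using this
  have sumS : ∀ F : V → ℝ, (∀ v, G.degree v = 1 → F v = 0) → ∑ v : S, F v = ∑ v, F v := by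
    intro F hF
    exact sum_sub_aux (fun v => v ∈ S) F (fun v hv => hF v (by simpa [S] using hv))
  obtain ⟨s, sinj, sadj, spos⟩ := ih (Fintype.card S)
    (by
      rw [← hm]
      exact Fintype.card_subtype_lt (p := fun v => v ∈ S) (x := l0) (by simp [S, hl0]))
    S (G.induce S) (fun i j => X i j) rfl hT' (fun i j => h0 _ _)
    (by
      rintro ⟨i, hi⟩
      have hi' : G.degree i ≠ 1 := hi
      rw [← hr i, ← sumS]
      intro v hv
      by_contra hne
      exact hi' ((hdeg _ _ hne).2 hv))
    (by
      rintro ⟨i, hi⟩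
      have hi' : G.degree i ≠ 1 := hi
      rw [← hcl i]
      refine sumS (fun v => X v i) ?_
      intro v hv
      by_contra hne
      exact hi' ((hdeg _ _ hne).1 hv))
    (by
      rintro ⟨i, hi⟩ ⟨j, hj⟩
      have hi' : G.degree i ≠ 1 := hi
      have hj' : G.degree j ≠ 1 := hj
      have := hcomm i j
      rw [← sumS, ← sumS] at this
      · simpa using this
      · intro v hv
        rw [ite_eq_right_iff]
        intro _
        by_contra hne
        exact hj' ((hdeg _ _ hne).1 hv)
      · intro v hv
        rw [ite_eq_right_iff]
        intro _
        by_contra hne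
        exact hi' ((hdeg _ _ hne).2 hv))
  -- lifting to the leaves
  have lift : ∀ p : S, ∃ e : {l // G.degree l = 1 ∧ G.Adj l p} →
      {l // G.degree l = 1 ∧ G.Adj l (s p)}, Function.Injective e ∧
      ∀ l, 0 < X (e l) l := by
    rintro p
    have hp : G.degree (p : V) ≠ 1 := p.2
    have hq : G.degree (s p : V) ≠ 1 := (s p).2
    refine hall_aux (α := {l // G.degree l = 1 ∧ G.Adj l p})
      (β := {l // G.degree l = 1 ∧ G.Adj l (s p)}) (fun l l' => X l'.1 l.1) (X (s p) p) (spos p) (fun _ _ => h0 _ _) ?_ ?_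
    · rintro ⟨l, hl, hlp⟩
      have h := hcomm (s p) l
      have e1 : (∑ k, if G.Adj k l then X (s p) k else 0) = X (s p) p := by
        rw [Finset.sum_eq_single (p : V)]
        · simp [hlp.symm]
        · intro b _ hb
          rw [if_neg]
          intro hbl
          exact hb (((hpar l hl _).1 hbl.symm).trans ((hpar l hl _).1 hlp).symm)
        · simp
      rw [e1] at h
      rw [h]
      refine Eq.trans (Finset.sum_congr rfl ?_)
        (sum_sub_aux (fun k => G.degree k = 1 ∧ G.Adj k (s p))
          (fun k => if G.Adj (s p) k then X k l else 0) ?_)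
      · rintro ⟨k, hk, hk'⟩ _
        simp [hk'.symm]
      · intro k hk
        rw [ite_eq_right_iff]
        intro hsk
        by_contra hne
        exact hk ⟨(hdeg _ _ hne).2 hl, hsk.symm⟩
    · rintro ⟨l, hl, hlp⟩
      have h := hcomm l p
      have e1 : (∑ k, if G.Adj l k then X k p else 0) = X (s p) p := by
        rw [Finset.sum_eq_single (s p : V)]
        · simp [hlp]
        · intro b _ hb
          rw [if_neg]
          intro hbl
          exact hb (((hpar l hl _).1 hbl).trans ((hpar l hl _).1 hlp).symm)
        · simp
      rw [e1] at h
      rw [← h]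
      refine Eq.trans (Finset.sum_congr rfl ?_)
        (sum_sub_aux (fun k => G.degree k = 1 ∧ G.Adj k p)
          (fun k => if G.Adj k p then X l k else 0) ?_)
      · rintro ⟨k, hk, hk'⟩ _
        simp [hk']
      · intro k hk
        rw [ite_eq_right_iff]
        intro hsk
        by_contra hne
        exact hk ⟨(hdeg _ _ hne).1 hl, hsk⟩
  choose e einj epos using lift
  let P : V → S := ret
  have hP : ∀ l, G.degree l = 1 → G.Adj l (P l) := by
    intro l hl
    simp only [P, ret, hl, dif_pos]
    exact (hpar l hl _).2 rfl
  have hPu : ∀ l w, G.degree l = 1 → G.Adj l w → w = P l := by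
    intro l w hl h
    rw [(hpar l hl _).1 h, (hpar l hl _).1 (hP l hl)]
  let g : V → V := fun v => if h : G.degree v = 1 then (e (P v) ⟨v, h, hP v h⟩).1
    else (s ⟨v, h⟩).1
  have gl : ∀ v (h : G.degree v = 1), g v = (e (P v) ⟨v, h, hP v h⟩).1 := fun v h => by
    simp [g, h]
  have gn : ∀ v (h : G.degree v ≠ 1), g v = (s ⟨v, h⟩).1 := fun v h => by
    simp [g, h]
  have gldeg : ∀ v (h : G.degree v = 1), G.degree (g v) = 1 := fun v h => by
    rw [gl v h]; exact (e (P v) ⟨v, h, hP v h⟩).2.1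
  have gndeg : ∀ v (h : G.degree v ≠ 1), G.degree (g v) ≠ 1 := fun v h => by
    rw [gn v h]; exact (s ⟨v, h⟩).2
  have gpar : ∀ v (h : G.degree v = 1), G.Adj (g v) (s (P v)) := fun v h => by
    rw [gl v h]; exact (e (P v) ⟨v, h, hP v h⟩).2.2
  have ginj : Function.Injective g := by
    intro u v huv
    by_cases hu : G.degree u = 1 <;> by_cases hv : G.degree v = 1
    · have h1 := hPu _ _ (gldeg u hu) (gpar u hu)
      have h2 := hPu _ _ (gldeg v hv) (gpar v hv)
      rw [huv, ← h2] at h1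
      have h3 : P u = P v := sinj (Subtype.ext h1)
      have h4 : ∀ q (hq : P v = q), g v = (e q ⟨v, hv, hq ▸ hP v hv⟩).1 := by
        rintro q rfl; exact gl v hv
      rw [gl u hu, h4 _ h3.symm] at huv
      have := einj _ (Subtype.ext huv)
      simpa using this
    · exact absurd (huv ▸ gldeg u hu) (gndeg v hv)
    · exact absurd (huv ▸ gldeg v hv) (gndeg u hu)
    · rw [gn u hu, gn v hv] at huv
      have := sinj (Subtype.ext huv)
      simpa using this
  have hadj : ∀ u v, G.degree u = 1 → (G.Adj u v ↔ G.Adj (g u) (g v)) := by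
    intro u v hu
    constructor
    · intro h
      have hv := hnl u v hu h
      have e1 : (⟨v, hv⟩ : S) = P u := Subtype.ext (hPu u v hu h)
      rw [gn v hv, e1]
      exact gpar u hu
    · intro h
      have hv : G.degree v ≠ 1 := fun hv => hnl _ _ (gldeg u hu) h (gldeg v hv)
      have h1 := hPu _ _ (gldeg u hu) h
      have h2 := hPu _ _ (gldeg u hu) (gpar u hu)
      rw [gn v hv, ← h2] at h1
      have h3 := congrArg Subtype.val (sinj (Subtype.ext h1))
      simp only at h3
      rw [h3]
      exact hP u hu
  refine ⟨g, ginj, ?_, ?_⟩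
  · intro u v
    by_cases hu : G.degree u = 1
    · exact hadj u v hu
    by_cases hv : G.degree v = 1
    · rw [G.adj_comm, G.adj_comm (g u)]
      exact hadj v u hv
    rw [gn u hu, gn v hv]
    exact sadj ⟨u, hu⟩ ⟨v, hv⟩
  · intro v
    by_cases hv : G.degree v = 1
    · rw [gl v hv]
      exact epos _ ⟨v, hv, hP v hv⟩
    · rw [gn v hv]
      exact spos ⟨v, hv⟩

lemma hull_aux (n : ℕ) (hn : 0 < n) (G : SimpleGraph (Fin n))
    [DecidableRel G.Adj] (htree : G.IsTree) : ∀ (m : ℕ) (X : Matrix (Fin n) (Fin n) ℝ),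
    (univ.filter (fun p : Fin n × Fin n => X p.1 p.2 ≠ 0)).card = m →
    IsDoublyStochastic X → X * G.adjMatrix ℝ = G.adjMatrix ℝ * X →
    X ∈ convexHull ℝ {M : Matrix (Fin n) (Fin n) ℝ |
      ∃ σ : Equiv.Perm (Fin n),
        (∀ u v : Fin n, G.Adj u v ↔ G.Adj (σ u) (σ v)) ∧ M = permMatrix n σ} := by
  intro m
  induction m using Nat.strong_induction_on with
  | _ m ih =>
  intro X hm hX hcomm
  obtain ⟨f, finj, fadj, fpos⟩ := exists_auto n (Fin n) G X (by simp) htree hX.1 hX.2.1 hX.2.2 (by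
    intro i j
    have := congrFun (congrFun hcomm i) j
    simp only [Matrix.mul_apply, SimpleGraph.adjMatrix_apply, mul_ite, mul_one, mul_zero, ite_mul,
      one_mul, zero_mul] at this
    convert this)
  let σ : Equiv.Perm (Fin n) := Equiv.ofBijective f (Finite.injective_iff_bijective.1 finj)
  have hσ : ∀ v, σ v = f v := fun v => rfl
  have hPmem : permMatrix n σ ∈ {M : Matrix (Fin n) (Fin n) ℝ |
      ∃ σ : Equiv.Perm (Fin n),
        (∀ u v : Fin n, G.Adj u v ↔ G.Adj (σ u) (σ v)) ∧ M = permMatrix n σ} := ⟨σ, fadj, rfl⟩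
  have : Nonempty (Fin n) := ⟨⟨0, hn⟩⟩
  obtain ⟨j0, hj0⟩ := Finite.exists_min (fun j => X (σ j) j)
  set t := X (σ j0) j0 with ht
  have tpos : 0 < t := fpos j0
  have hle : ∀ i j, X i j ≤ 1 := by
    intro i j
    rw [← hX.2.2 j]
    exact Finset.single_le_sum (f := fun i => X i j) (fun i _ => hX.1 i j) (mem_univ i)
  rcases (hle (σ j0) j0).lt_or_eq with hlt | heq
  · have h1t : 0 < 1 - t := by linarith
    have hPcomm : permMatrix n σ * G.adjMatrix ℝ = G.adjMatrix ℝ * permMatrix n σ := by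
      ext i j
      simp only [Matrix.mul_apply, permMatrix, SimpleGraph.adjMatrix_apply]
      rw [Finset.sum_eq_single (σ.symm i), Finset.sum_eq_single (σ j)]
      · have := fadj (σ.symm i) j
        rw [← hσ, ← hσ, Equiv.apply_symm_apply] at this
        simp [this]
      · intro b _ hb; simp [Ne.symm hb]
      · simp
      · intro b _ hb
        rw [if_neg, zero_mul]
        intro h; exact hb (by rw [← h]; simp)
      · simp
    have hPr : ∀ i, ∑ j, permMatrix n σ i j = 1 := by
      intro i
      simp only [permMatrix]
      rw [Finset.sum_eq_single (σ.symm i)]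
      · simp
      · intro b _ hb
        rw [if_neg]
        intro h; exact hb (by rw [← h]; simp)
      · simp
    have hPc : ∀ j, ∑ i, permMatrix n σ i j = 1 := by
      intro i
      simp [permMatrix]
    let Y : Matrix (Fin n) (Fin n) ℝ := (1 - t)⁻¹ • (X - t • permMatrix n σ)
    have hYa : ∀ i j, Y i j = (1 - t)⁻¹ * (X i j - t * permMatrix n σ i j) := fun i j => by
      simp [Y]
    have hY : Y ∈ convexHull ℝ {M : Matrix (Fin n) (Fin n) ℝ |
      ∃ σ : Equiv.Perm (Fin n),
        (∀ u v : Fin n, G.Adj u v ↔ G.Adj (σ u) (σ v)) ∧ M = permMatrix n σ} := by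
      refine ih _ ?_ Y rfl ⟨?_, ?_, ?_⟩ ?_
      · rw [← hm]
        apply Finset.card_lt_card
        rw [Finset.ssubset_iff_of_subset]
        · refine ⟨(σ j0, j0), by simpa [← ht] using tpos.ne', ?_⟩
          simp [hYa, permMatrix, ← ht]
        · rintro ⟨i, j⟩ h
          simp only [mem_filter, mem_univ, true_and, hYa] at h ⊢
          intro h'
          apply h
          have : σ j ≠ i := by
            rintro rfl
            exact (fpos j).ne' h'
          simp [h', permMatrix, this]
      · intro i j
        rw [hYa]
        refine mul_nonneg (inv_nonneg.2 h1t.le) ?_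
        by_cases h : σ j = i
        · subst h
          have := hj0 j
          simpa [permMatrix] using this
        · simpa [permMatrix, h] using hX.1 i j
      · intro i
        simp only [hYa, ← Finset.mul_sum, Finset.sum_sub_distrib, hPr, hX.2.1]
        field_simp
      · intro i
        simp only [hYa, ← Finset.mul_sum, Finset.sum_sub_distrib, hPc, hX.2.2]
        field_simp
      · simp only [Y, Matrix.smul_mul, Matrix.mul_smul, Matrix.sub_mul, Matrix.mul_sub, hPcomm,
          hcomm]
    have hXe : X = (1 - t) • Y + t • permMatrix n σ := by
      simp only [Y]
      rw [smul_inv_smul₀ h1t.ne']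
      simp
    rw [hXe]
    exact convex_convexHull ℝ _ hY (subset_convexHull ℝ _ hPmem) h1t.le tpos.le (by ring)
  · apply subset_convexHull
    convert hPmem
    have h1 : ∀ j, X (σ j) j = 1 := fun j => le_antisymm (hle _ _) (by
      have := hj0 j
      rw [← ht] at heq
      linarith)
    ext i j
    by_cases h : σ j = i
    · subst h
      simp [h1, permMatrix]
    · simp only [permMatrix, h, if_false]
      have h2 := Finset.sum_le_sum_of_subset_of_nonneg (f := fun i => X i j)
        (Finset.subset_univ {σ j, i}) (fun i _ _ => hX.1 i j)
      rw [Finset.sum_pair h, hX.2.2, h1] at h2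
      exact le_antisymm (by linarith) (hX.1 i j)

/-- Trees are compact: every doubly stochastic matrix commuting with the
adjacency matrix of a tree lies in the convex hull of the permutation matrices
of automorphisms of the tree. -/
theorem tree_compact (n : ℕ) (hn : 0 < n) (G : SimpleGraph (Fin n))
    [DecidableRel G.Adj] (htree : G.IsTree) (X : Matrix (Fin n) (Fin n) ℝ)
    (hX : IsDoublyStochastic X)
    (hcomm : X * G.adjMatrix ℝ = G.adjMatrix ℝ * X) :
    X ∈ convexHull ℝ {M : Matrix (Fin n) (Fin n) ℝ |
      ∃ σ : Equiv.Perm (Fin n),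
        (∀ u v : Fin n, G.Adj u v ↔ G.Adj (σ u) (σ v)) ∧ M = permMatrix n σ} :=
  hull_aux n hn G htree _ X rfl hX hcomm
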